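/- Let A = C(α₀, α₁, …, α_{n−1}) = Σ_{i=0}^{n−1} α_i S^i be an n×n circulant matrix with α_i ∈ ℂ. Then A is logarithmic affine if and only if there exist β, ω ∈ ℂ with |β| = 1 and ω^n = 1 such that α_i ω^i = β|α_i| for all i = 0,1,…,n−1 (equivalently, A = β·C(|α₀|, ω̄|α₁|, ω̄²|α₂|, …, ω̄^{n−1}|α_{n−1}|)). In particular, if A is logarithmic affine then ‖A‖_{p,p} = Σ_{i=0}^{n−1} |α_i| for every p ∈ [1,∞]. -/

import Mathlib

open scoped BigOperators ENNReal
open Matrix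

/-- The `ℓ^p` norm of a finitely-indexed vector (with the convention `1/∞ = 0`). -/
noncomputable def lpNorm {ι : Type*} [Fintype ι] {E : Type*} [Norm E] (p : ℝ≥0∞)
    (x : ι → E) : ℝ :=
  if p = ∞ then ⨆ i, ‖x i‖ else (∑ i, ‖x i‖ ^ p.toReal) ^ p.toReal⁻¹

/-- The operator norm of a square complex matrix acting on `ℓ^p`. -/
noncomputable def opNorm {ι : Type*} [Fintype ι] (p : ℝ≥0∞) (A : Matrix ι ι ℂ) : ℝ :=
  sSup {r : ℝ | ∃ x : ι → ℂ, lpNorm p x = 1 ∧ r = lpNorm p (A.mulVec x)}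

/-- A unitary permutation matrix: a permutation matrix whose nonzero entries are
unimodular complex numbers. -/
def IsUnitaryPermutation {n : ℕ} (S : Matrix (Fin n) (Fin n) ℂ) : Prop :=
  ∃ (σ : Equiv.Perm (Fin n)) (α : Fin n → ℂ), (∀ i, ‖α i‖ = 1) ∧
    ∀ i j, S i j = if j = σ i then α i else 0

/-- `A` is logarithmic affine: `‖A‖_{p,p} = ‖A‖_{1,1}^{1/p} ‖A‖_{∞,∞}^{1-1/p}` for all
`p ∈ [1,∞]` (with `1/∞ = 0`). -/
def LogAffine {ι : Type*} [Fintype ι] (A : Matrix ι ι ℂ) : Prop :=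
  ∀ p : ℝ≥0∞, 1 ≤ p →
    opNorm p A = opNorm 1 A ^ p.toReal⁻¹ * opNorm ⊤ A ^ (1 - p.toReal⁻¹)

/-- The circulant matrix `C(α₀,…,α_{n-1})`, whose `(i,j)` entry is `α_{j-i mod n}`. -/
noncomputable def circulantC {n : ℕ} (α : Fin n → ℂ) : Matrix (Fin n) (Fin n) ℂ :=
  Matrix.of fun i j => α (j - i)

/-- The Hankel-type matrix `H(α₀,…,α_{n-1})`, whose `(i,j)` entry is `α_{i+j mod n}`. -/
noncomputable def hankelH {n : ℕ} (α : Fin n → ℂ) : Matrix (Fin n) (Fin n) ℂ :=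
  Matrix.of fun i j => α (i + j)

open scoped ComplexConjugate

section LpNorm

variable {ι : Type*} [Fintype ι]

lemma lpNorm_eq_norm_toLp {p : ℝ≥0∞} (hp : 1 ≤ p) (x : ι → ℂ) :
    lpNorm p x = ‖WithLp.toLp p x‖ := by
  unfold lpNorm
  split_ifs with h
  · subst h
    exact (PiLp.norm_eq_ciSup _).symm
  · rw [PiLp.norm_eq_sum (ENNReal.toReal_pos (by positivity) h), one_div]

lemma lpNorm_nonneg {p : ℝ≥0∞} (hp : 1 ≤ p) (x : ι → ℂ) : 0 ≤ lpNorm p x := by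
  have := Fact.mk hp
  rw [lpNorm_eq_norm_toLp hp]
  positivity

lemma lpNorm_smul {p : ℝ≥0∞} (hp : 1 ≤ p) (c : ℂ) (x : ι → ℂ) :
    lpNorm p (c • x) = ‖c‖ * lpNorm p x := by
  have := Fact.mk hp
  rw [lpNorm_eq_norm_toLp hp, lpNorm_eq_norm_toLp hp, WithLp.toLp_smul, norm_smul]

lemma lpNorm_sum_le {κ : Type*} {p : ℝ≥0∞} (hp : 1 ≤ p) (s : Finset κ) (f : κ → ι → ℂ) :
    lpNorm p (∑ k ∈ s, f k) ≤ ∑ k ∈ s, lpNorm p (f k) := by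
  have := Fact.mk hp
  simp only [lpNorm_eq_norm_toLp hp, WithLp.toLp_sum]
  exact norm_sum_le _ _

lemma lpNorm_pos {p : ℝ≥0∞} (hp : 1 ≤ p) {x : ι → ℂ} (hx : x ≠ 0) : 0 < lpNorm p x := by
  have := Fact.mk hp
  rw [lpNorm_eq_norm_toLp hp, norm_pos_iff]
  simpa using hx

lemma lpNorm_comp_equiv (p : ℝ≥0∞) (e : ι ≃ ι) (x : ι → ℂ) :
    lpNorm p (fun i => x (e i)) = lpNorm p x := by
  unfold lpNorm
  rw [e.iSup_comp (g := fun i => ‖x i‖), Equiv.sum_comp e (fun i => ‖x i‖ ^ p.toReal)]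

lemma lpNorm_one (x : ι → ℂ) : lpNorm 1 x = ∑ i, ‖x i‖ := by
  simp [lpNorm]

lemma lpNorm_two_sq (x : ι → ℂ) : lpNorm 2 x ^ 2 = ∑ i, ‖x i‖ ^ 2 := by
  rw [lpNorm_eq_norm_toLp one_le_two]
  exact EuclideanSpace.norm_sq_eq _

lemma opNorm_le [Nonempty ι] {p : ℝ≥0∞} (hp : 1 ≤ p) {A : Matrix ι ι ℂ} {M : ℝ}
    (h : ∀ x, lpNorm p (A *ᵥ x) ≤ M * lpNorm p x) : opNorm p A ≤ M := by
  refine csSup_le ?_ ?_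
  · have h1 := lpNorm_pos hp (x := fun _ : ι => 1) (Function.const_ne_zero.2 one_ne_zero)
    refine ⟨_, ((lpNorm p fun _ : ι => (1 : ℂ) : ℝ) : ℂ)⁻¹ • (fun _ : ι => (1 : ℂ)), ?_, rfl⟩
    rw [lpNorm_smul hp, norm_inv, Complex.norm_real, Real.norm_of_nonneg h1.le,
      inv_mul_cancel₀ h1.ne']
  · rintro r ⟨x, hx, rfl⟩
    simpa [hx] using h x

lemma le_opNorm {p : ℝ≥0∞} (hp : 1 ≤ p) {A : Matrix ι ι ℂ} {M c : ℝ}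
    (h : ∀ x, lpNorm p (A *ᵥ x) ≤ M * lpNorm p x) {x : ι → ℂ} (hx : x ≠ 0)
    (hc : c * lpNorm p x ≤ lpNorm p (A *ᵥ x)) : c ≤ opNorm p A := by
  have h1 := lpNorm_pos hp hx
  have h2 : c ≤ (lpNorm p x)⁻¹ * lpNorm p (A *ᵥ x) := by
    rwa [inv_mul_eq_div, le_div_iff₀ h1]
  refine h2.trans (le_csSup ⟨M, ?_⟩ ⟨((lpNorm p x : ℝ) : ℂ)⁻¹ • x, ?_, ?_⟩)
  · rintro r ⟨y, hy, rfl⟩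
    simpa [hy] using h y
  · rw [lpNorm_smul hp, norm_inv, Complex.norm_real, Real.norm_of_nonneg h1.le,
      inv_mul_cancel₀ h1.ne']
  · rw [mulVec_smul, lpNorm_smul hp, norm_inv, Complex.norm_real, Real.norm_of_nonneg h1.le]

end LpNorm

/-- Equality in the triangle inequality for complex numbers. -/
lemma exists_eq_mul_norm_of_norm_sum_eq {ι : Type*} [Fintype ι] (z : ι → ℂ)
    (h : ∑ i, ‖z i‖ ≤ ‖∑ i, z i‖) : ∃ β : ℂ, ‖β‖ = 1 ∧ ∀ i, z i = β * (‖z i‖ : ℂ) := by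
  obtain ⟨β, hβ, hz⟩ : ∃ β : ℂ, ‖β‖ = 1 ∧ ∑ i, z i = β * (‖∑ i, z i‖ : ℂ) := by
    by_cases h0 : ∑ i, z i = 0
    · exact ⟨1, by simp, by simp [h0]⟩
    · have : (‖∑ i, z i‖ : ℂ) ≠ 0 := by simpa using h0
      refine ⟨(∑ i, z i) / (‖∑ i, z i‖ : ℂ), ?_, by field_simp⟩
      rw [norm_div, Complex.norm_real, norm_norm, div_self (by simpa using h0)]
  refine ⟨β, hβ, ?_⟩
  have hββ : conj β * β = 1 := by
    rw [← Complex.normSq_eq_conj_mul_self, Complex.normSq_eq_norm_sq, hβ]; simp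
  have hle : ∀ i, (conj β * z i).re ≤ ‖z i‖ := fun i =>
    (Complex.re_le_norm _).trans (by simp [hβ])
  have hsum : ∑ i, ‖z i‖ ≤ ∑ i, (conj β * z i).re := by
    refine h.trans_eq ?_
    rw [← Complex.re_sum, ← Finset.mul_sum, hz, ← mul_assoc, hββ]
    simp [hβ]
  have heq := (Finset.sum_eq_sum_iff_of_le fun i _ => hle i).1
    (le_antisymm (Finset.sum_le_sum fun i _ => hle i) hsum)
  intro i
  have hre := heq i (Finset.mem_univ i)
  have hn : ‖conj β * z i‖ = ‖z i‖ := by simp [hβ]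
  have him : (conj β * z i).im = 0 := by
    have := Complex.sq_norm (conj β * z i)
    rw [hn, Complex.normSq_apply, hre] at this
    nlinarith
  have : conj β * z i = (‖z i‖ : ℂ) := Complex.ext (by simpa using hre) (by simpa using him)
  rw [← this, ← mul_assoc, mul_comm β, hββ, one_mul]

section Fourier

variable {G : Type*} [AddCommGroup G] [Fintype G]

lemma sum_norm_sq_fourier (x : G → ℂ) :
    ∑ ψ : AddChar G ℂ, ‖∑ j, x j * ψ j‖ ^ 2 = Fintype.card G * ∑ j, ‖x j‖ ^ 2 := by
  classical
  have key : ∀ ψ : AddChar G ℂ, ((‖∑ j, x j * ψ j‖ ^ 2 : ℝ) : ℂ) =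
      ∑ j, ∑ k, x j * conj (x k) * ψ (j - k) := by
    intro ψ
    push_cast
    rw [← Complex.mul_conj', map_sum, Finset.sum_mul_sum]
    refine Finset.sum_congr rfl fun j _ => Finset.sum_congr rfl fun k _ => ?_
    rw [sub_eq_add_neg, AddChar.map_add_eq_mul, AddChar.map_neg_eq_conj, map_mul]
    ring
  apply Complex.ofReal_injective
  rw [Complex.ofReal_sum]
  simp_rw [key]
  rw [Finset.sum_comm]
  simp_rw [Finset.sum_comm (s := (Finset.univ : Finset (AddChar G ℂ))), ← Finset.mul_sum,
    AddChar.sum_apply_eq_ite, sub_eq_zero]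
  simp [Finset.mul_sum, Complex.mul_conj', mul_comm]

lemma fourier_convolution (α x : G → ℂ) (ψ : AddChar G ℂ) :
    ∑ i, (∑ d, α d * x (i + d)) * ψ i = (∑ d, α d * ψ (-d)) * ∑ j, x j * ψ j := by
  simp_rw [Finset.sum_mul]
  rw [Finset.sum_comm]
  refine Finset.sum_congr rfl fun d _ => ?_
  rw [Finset.mul_sum, ← Equiv.sum_comp (Equiv.addRight d) (fun j => _ * (x j * ψ j))]
  refine Finset.sum_congr rfl fun i _ => ?_
  have : ψ i = ψ (-d) * ψ (i + d) := by rw [← AddChar.map_add_eq_mul]; simp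
  rw [this]
  simp only [Equiv.coe_addRight]
  ring

lemma lpNorm_two_convolution_le (α x : G → ℂ) {M : ℝ}
    (hM : ∀ ψ : AddChar G ℂ, ‖∑ d, α d * ψ d‖ ≤ M) :
    lpNorm 2 (fun i => ∑ d, α d * x (i + d)) ≤ M * lpNorm 2 x := by
  have hM0 : 0 ≤ M := (norm_nonneg _).trans (hM 0)
  refine le_of_sq_le_sq ?_ (mul_nonneg hM0 (lpNorm_nonneg one_le_two x))
  rw [mul_pow, lpNorm_two_sq, lpNorm_two_sq]
  refine le_of_mul_le_mul_left ?_ (Nat.cast_pos.2 (Fintype.card_pos (α := G)) : (0 : ℝ) < _)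
  rw [← sum_norm_sq_fourier, mul_left_comm, ← sum_norm_sq_fourier, Finset.mul_sum]
  refine Finset.sum_le_sum fun ψ _ => ?_
  rw [fourier_convolution, norm_mul, mul_pow]
  gcongr
  simpa using hM (-ψ)

end Fourier

section Circulant

variable {n : ℕ} [NeZero n] (α : Fin n → ℂ)

lemma circulantC_mulVec (x : Fin n → ℂ) :
    circulantC α *ᵥ x = fun i => ∑ d, α d * x (i + d) := by
  ext i
  rw [mulVec, dotProduct, ← Equiv.sum_comp (Equiv.addLeft i)]
  simp [circulantC]

lemma lpNorm_circulantC_mulVec_le {p : ℝ≥0∞} (hp : 1 ≤ p) (x : Fin n → ℂ) :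
    lpNorm p (circulantC α *ᵥ x) ≤ (∑ i, ‖α i‖) * lpNorm p x := by
  have : circulantC α *ᵥ x = ∑ d, α d • fun i => x (i + d) := by
    rw [circulantC_mulVec]
    ext i
    simp
  rw [this, Finset.sum_mul]
  refine (lpNorm_sum_le hp _ _).trans_eq (Finset.sum_congr rfl fun d _ => ?_)
  rw [lpNorm_smul hp, ← lpNorm_comp_equiv p (Equiv.addRight d) x]
  rfl

lemma opNorm_circulantC_le {p : ℝ≥0∞} (hp : 1 ≤ p) :
    opNorm p (circulantC α) ≤ ∑ i, ‖α i‖ :=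
  opNorm_le hp (lpNorm_circulantC_mulVec_le α hp)

lemma opNorm_one_circulantC : opNorm 1 (circulantC α) = ∑ i, ‖α i‖ := by
  refine le_antisymm (opNorm_circulantC_le α le_rfl)
    (le_opNorm le_rfl (lpNorm_circulantC_mulVec_le α le_rfl) (x := Pi.single 0 1) (by simp) ?_)
  rw [lpNorm_one, lpNorm_one, mulVec_single_one, ← Equiv.sum_comp (Equiv.neg (Fin n))]
  simp [circulantC, Pi.single_apply, apply_ite norm]

lemma opNorm_top_circulantC : opNorm ⊤ (circulantC α) = ∑ i, ‖α i‖ := by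
  have hu : ∀ z : ℂ, ∃ u : ℂ, ‖u‖ = 1 ∧ z * u = ‖z‖ := by
    intro z
    by_cases hz : z = 0
    · exact ⟨1, by simp, by simp [hz]⟩
    · have h0 : (‖z‖ : ℂ) ≠ 0 := by simpa using hz
      refine ⟨‖z‖ / z, by simp [hz], by field_simp⟩
  choose u hu1 hu2 using hu
  have hx : (fun i => u (α i)) ≠ 0 := fun h => by
    simpa [congrFun h 0] using hu1 (α 0)
  refine le_antisymm (opNorm_circulantC_le α le_top)
    (le_opNorm le_top (lpNorm_circulantC_mulVec_le α le_top) hx ?_)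
  have h0 : (circulantC α *ᵥ fun i => u (α i)) 0 = ((∑ i, ‖α i‖ : ℝ) : ℂ) := by
    simp [circulantC_mulVec, hu2]
  have h1 := le_ciSup (Set.finite_range fun i => ‖(circulantC α *ᵥ fun i => u (α i)) i‖).bddAbove 0
  simp only [h0, Complex.norm_real] at h1
  simpa [lpNorm, hu1] using (Real.le_norm_self _).trans h1

lemma exists_of_logAffine (h : LogAffine (circulantC α)) :
    ∃ β ω : ℂ, ‖β‖ = 1 ∧ ω ^ n = 1 ∧ ∀ i : Fin n, α i * ω ^ (i : ℕ) = β * (‖α i‖ : ℂ) := by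
  have hs : (0 : ℝ) ≤ ∑ i, ‖α i‖ := by positivity
  have h2 : opNorm 2 (circulantC α) = ∑ i, ‖α i‖ := by
    rw [h 2 one_le_two, opNorm_one_circulantC, opNorm_top_circulantC,
      ← Real.rpow_add_of_nonneg hs (by norm_num) (by norm_num)]
    norm_num
  obtain ⟨χ, hχ⟩ := Finite.exists_max fun ψ : AddChar (Fin n) ℂ => ‖∑ d, α d * ψ d‖
  have hle : ∑ i, ‖α i‖ ≤ ‖∑ d, α d * χ d‖ := by
    rw [← h2]
    refine opNorm_le one_le_two fun x => ?_
    rw [circulantC_mulVec]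
    exact lpNorm_two_convolution_le α x hχ
  obtain ⟨β, hβ, hz⟩ := exists_eq_mul_norm_of_norm_sum_eq (fun d => α d * χ d) (by simpa using hle)
  have hpow : ∀ k : ℕ, χ 1 ^ k = χ (Fin.ofNat n k) := by
    intro k
    rw [← AddChar.map_nsmul_eq_pow]
    congr 1
    induction k with
    | zero => ext; simp
    | succ k ih => rw [succ_nsmul, ih]; ext; simp [Fin.val_add]
  refine ⟨β, χ 1, hβ, ?_, fun i => ?_⟩
  · rw [hpow, Fin.ofNat_self, AddChar.map_zero_eq_one]
  · simpa [hpow] using hz i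

variable {α} in
lemma opNorm_circulantC_of_phase {β ω : ℂ} (hβ : ‖β‖ = 1) (hω : ω ^ n = 1)
    (h : ∀ i : Fin n, α i * ω ^ (i : ℕ) = β * (‖α i‖ : ℂ)) {p : ℝ≥0∞} (hp : 1 ≤ p) :
    opNorm p (circulantC α) = ∑ i, ‖α i‖ := by
  have hx : (fun i : Fin n => ω ^ (i : ℕ)) ≠ 0 := fun h0 => by
    simpa using congrFun h0 0
  refine le_antisymm (opNorm_circulantC_le α hp)
    (le_opNorm hp (lpNorm_circulantC_mulVec_le α hp) hx ?_)
  have heig : circulantC α *ᵥ (fun i : Fin n => ω ^ (i : ℕ)) =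
      (β * ((∑ i, ‖α i‖ : ℝ) : ℂ)) • fun i : Fin n => ω ^ (i : ℕ) := by
    rw [circulantC_mulVec]
    ext i
    simp only [Fin.val_add, Pi.smul_apply, smul_eq_mul, Complex.ofReal_sum, Finset.mul_sum,
      Finset.sum_mul, ← h]
    refine Finset.sum_congr rfl fun d _ => ?_
    rw [← pow_eq_pow_mod _ hω, pow_add]
    ring
  rw [heig, lpNorm_smul hp, norm_mul, hβ, one_mul, Complex.norm_real]
  exact mul_le_mul_of_nonneg_right (Real.le_norm_self _) (lpNorm_nonneg hp _)

end Circulant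

theorem statement11 {n : ℕ} (hn : 0 < n) (α : Fin n → ℂ) :
    (LogAffine (circulantC α) ↔ ∃ β ω : ℂ, ‖β‖ = 1 ∧ ω ^ n = 1 ∧
      ∀ i : Fin n, α i * ω ^ (i : ℕ) = β * (‖α i‖ : ℂ)) ∧
    (LogAffine (circulantC α) →
      ∀ p : ℝ≥0∞, 1 ≤ p → opNorm p (circulantC α) = ∑ i, ‖α i‖) := by
  have : NeZero n := ⟨hn.ne'⟩
  refine ⟨⟨exists_of_logAffine α, ?_⟩, fun hA p hp => ?_⟩
  · rintro ⟨β, ω, hβ, hω, h⟩ p hp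
    have hs : (0 : ℝ) ≤ ∑ i, ‖α i‖ := by positivity
    have hp1 : p.toReal⁻¹ ≤ 1 := by
      rcases eq_or_ne p ⊤ with rfl | hpt
      · simp
      · exact inv_le_one_of_one_le₀ (by simpa using ENNReal.toReal_mono hpt hp)
    rw [opNorm_circulantC_of_phase hβ hω h hp, opNorm_one_circulantC, opNorm_top_circulantC,
      ← Real.rpow_add_of_nonneg hs (by positivity) (by linarith)]
    simp
  · obtain ⟨β, ω, hβ, hω, h⟩ := exists_of_logAffine α hA
    exact opNorm_circulantC_of_phase hβ hω h hp
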